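/- Let n ≥ 3 be an integer and K a field with char K ∉ {2,3} containing n distinct n-th roots of unity. Let I = (x(y^n − z^n), y(z^n − x^n), z(x^n − y^n)) ⊆ R = K[x,y,z] be the defining ideal of the Fermat configuration of points. Then I^(3) ⊄ I^2: there is an element of the third symbolic power I^(3) that does not belong to I^2. -/

import Mathlib

open MvPolynomial

namespace FermatConfiguration

/-- The exponent vector `(a, b, c)` of the monomial `xᵃ yᵇ zᶜ`. -/
noncomputable def expo (a b c : ℕ) : Fin 3 →₀ ℕ :=
  Finsupp.single 0 a + Finsupp.single 1 b + Finsupp.single 2 c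

section Coefficients

variable {K : Type*} [CommRing K]

theorem monomial_expo (a b c : ℕ) :
    (monomial (expo a b c) 1 : MvPolynomial (Fin 3) K) = X 0 ^ a * X 1 ^ b * X 2 ^ c := by
  simp [expo, X_pow_eq_monomial, monomial_mul]

theorem expo_le_expo {a b c i j k : ℕ} :
    expo i j k ≤ expo a b c ↔ i ≤ a ∧ j ≤ b ∧ k ≤ c := by
  simp [Finsupp.le_def, Fin.forall_fin_succ, expo]

theorem expo_sub_expo (a b c i j k : ℕ) :
    expo a b c - expo i j k = expo (a - i) (b - j) (c - k) := by
  ext t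
  fin_cases t <;> simp [expo]

theorem expo_eq_zero {a b c : ℕ} : expo a b c = 0 ↔ a = 0 ∧ b = 0 ∧ c = 0 := by
  simp [Finsupp.ext_iff, Fin.forall_fin_succ, expo, and_assoc]

theorem coeff_expo_mul (p : MvPolynomial (Fin 3) K) (a b c i j k : ℕ) :
    coeff (expo a b c) (p * (X 0 ^ i * X 1 ^ j * X 2 ^ k)) =
      if i ≤ a ∧ j ≤ b ∧ k ≤ c then coeff (expo (a - i) (b - j) (c - k)) p else 0 := by
  rw [← monomial_expo, coeff_mul_monomial']
  simp [expo_le_expo, expo_sub_expo]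

theorem coeff_expo_one (a b c : ℕ) :
    coeff (expo a b c) (1 : MvPolynomial (Fin 3) K) =
      if a = 0 ∧ b = 0 ∧ c = 0 then 1 else 0 := by
  simp [coeff_one, eq_comm (a := (0 : Fin 3 →₀ ℕ)), expo_eq_zero]

/-- Every element of the square of the Fermat ideal has equal coefficients at `xⁿ y²ⁿ`
and `xⁿ z²ⁿ`. -/
theorem coeff_eq_of_mem_sq {n : ℕ} (hn : 1 ≤ n) {G : MvPolynomial (Fin 3) K}
    (hG : G ∈ (Ideal.span {X 0 * (X 1 ^ n - X 2 ^ n), X 1 * (X 2 ^ n - X 0 ^ n),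
        X 2 * (X 0 ^ n - X 1 ^ n)} : Ideal (MvPolynomial (Fin 3) K)) ^ 2) :
    coeff (expo n (2 * n) 0) G = coeff (expo n 0 (2 * n)) G := by
  suffices h : ∀ p, coeff (expo n (2 * n) 0) (p * G) = coeff (expo n 0 (2 * n)) (p * G) by
    simpa using h 1
  rw [pow_two, Ideal.span_mul_span'] at hG
  induction hG using Submodule.span_induction with
  | zero => simp
  | add u v _ _ hu hv => intro p; simp [mul_add, hu p, hv p]
  | smul r u _ hu => intro p; simpa [mul_assoc] using hu (p * r)
  | mem u hu =>
    intro p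
    have hxx : p * (X 0 * (X 1 ^ n - X 2 ^ n) * (X 0 * (X 1 ^ n - X 2 ^ n))) =
        p * (X 0 ^ 2 * X 1 ^ (2 * n) * X 2 ^ 0) - p * (X 0 ^ 2 * X 1 ^ n * X 2 ^ n)
          - p * (X 0 ^ 2 * X 1 ^ n * X 2 ^ n) + p * (X 0 ^ 2 * X 1 ^ 0 * X 2 ^ (2 * n)) := by
      ring
    have hyy : p * (X 1 * (X 2 ^ n - X 0 ^ n) * (X 1 * (X 2 ^ n - X 0 ^ n))) =
        p * (X 0 ^ 0 * X 1 ^ 2 * X 2 ^ (2 * n)) - p * (X 0 ^ n * X 1 ^ 2 * X 2 ^ n)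
          - p * (X 0 ^ n * X 1 ^ 2 * X 2 ^ n) + p * (X 0 ^ (2 * n) * X 1 ^ 2 * X 2 ^ 0) := by
      ring
    have hzz : p * (X 2 * (X 0 ^ n - X 1 ^ n) * (X 2 * (X 0 ^ n - X 1 ^ n))) =
        p * (X 0 ^ (2 * n) * X 1 ^ 0 * X 2 ^ 2) - p * (X 0 ^ n * X 1 ^ n * X 2 ^ 2)
          - p * (X 0 ^ n * X 1 ^ n * X 2 ^ 2) + p * (X 0 ^ 0 * X 1 ^ (2 * n) * X 2 ^ 2) := by
      ring
    have hxy : p * (X 0 * (X 1 ^ n - X 2 ^ n) * (X 1 * (X 2 ^ n - X 0 ^ n))) =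
        p * (X 0 ^ 1 * X 1 ^ (n + 1) * X 2 ^ n) - p * (X 0 ^ (n + 1) * X 1 ^ (n + 1) * X 2 ^ 0)
          - p * (X 0 ^ 1 * X 1 ^ 1 * X 2 ^ (2 * n)) + p * (X 0 ^ (n + 1) * X 1 ^ 1 * X 2 ^ n) := by
      ring
    have hxz : p * (X 0 * (X 1 ^ n - X 2 ^ n) * (X 2 * (X 0 ^ n - X 1 ^ n))) =
        p * (X 0 ^ (n + 1) * X 1 ^ n * X 2 ^ 1) - p * (X 0 ^ 1 * X 1 ^ (2 * n) * X 2 ^ 1)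
          - p * (X 0 ^ (n + 1) * X 1 ^ 0 * X 2 ^ (n + 1))
          + p * (X 0 ^ 1 * X 1 ^ n * X 2 ^ (n + 1)) := by
      ring
    have hyz : p * (X 1 * (X 2 ^ n - X 0 ^ n) * (X 2 * (X 0 ^ n - X 1 ^ n))) =
        p * (X 0 ^ n * X 1 ^ 1 * X 2 ^ (n + 1)) - p * (X 0 ^ 0 * X 1 ^ (n + 1) * X 2 ^ (n + 1))
          - p * (X 0 ^ (2 * n) * X 1 ^ 1 * X 2 ^ 1) + p * (X 0 ^ n * X 1 ^ (n + 1) * X 2 ^ 1) := by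
      ring
    have hn0 : n ≠ 0 := by omega
    have hn2 : ¬ 2 * n ≤ n := by omega
    obtain ⟨a, ha, b, hb, rfl⟩ := Set.mem_mul.mp hu
    simp only [Set.mem_insert_iff, Set.mem_singleton_iff] at ha hb
    rcases ha with rfl | rfl | rfl <;> rcases hb with rfl | rfl | rfl
    on_goal 4 => rw [mul_comm (X 1 * _)]
    on_goal 7 => rw [mul_comm (X 2 * _)]
    on_goal 8 => rw [mul_comm (X 2 * _)]
    all_goals
      simp only [hxx, hyy, hzz, hxy, hxz, hyz, coeff_add, coeff_sub, coeff_expo_mul]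
      simp [hn0, hn2]

/-- The coefficients of `(xⁿ - yⁿ)(yⁿ - zⁿ)(zⁿ - xⁿ)` at `xⁿ y²ⁿ` and `xⁿ z²ⁿ` are `1` and `-1`. -/
theorem coeff_fermat_arrangement {n : ℕ} (hn : 1 ≤ n) :
    coeff (expo n (2 * n) 0)
        ((X 0 ^ n - X 1 ^ n) * (X 1 ^ n - X 2 ^ n) * (X 2 ^ n - X 0 ^ n) :
          MvPolynomial (Fin 3) K) = 1 ∧
      coeff (expo n 0 (2 * n))
        ((X 0 ^ n - X 1 ^ n) * (X 1 ^ n - X 2 ^ n) * (X 2 ^ n - X 0 ^ n) :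
          MvPolynomial (Fin 3) K) = -1 := by
  have hF : ((X 0 ^ n - X 1 ^ n) * (X 1 ^ n - X 2 ^ n) * (X 2 ^ n - X 0 ^ n) :
      MvPolynomial (Fin 3) K) =
      1 * (X 0 ^ n * X 1 ^ (2 * n) * X 2 ^ 0) - 1 * (X 0 ^ n * X 1 ^ 0 * X 2 ^ (2 * n))
      + 1 * (X 0 ^ (2 * n) * X 1 ^ 0 * X 2 ^ n) - 1 * (X 0 ^ (2 * n) * X 1 ^ n * X 2 ^ 0)
      + 1 * (X 0 ^ 0 * X 1 ^ n * X 2 ^ (2 * n)) - 1 * (X 0 ^ 0 * X 1 ^ (2 * n) * X 2 ^ n) := by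
    ring
  have hn0 : n ≠ 0 := by omega
  have hn2 : ¬ 2 * n ≤ n := by omega
  simp only [hF, coeff_add, coeff_sub, coeff_expo_mul, coeff_expo_one]
  constructor <;> simp [hn0, hn2]

end Coefficients

/-- If `u a` and `v b` lie in `I`, and `a, b` are outside the prime `P`, then some multiple of
`(uⁿ - vⁿ) c` by an element outside `P` lies in `I³`, for `n ≥ 3`. -/
theorem exists_notMem_mul_mem_cube {R : Type*} [CommRing R] {I P : Ideal R} [P.IsPrime] {n : ℕ}
    (hn : 3 ≤ n) {a b u v : R} (ha : a ∉ P) (hb : b ∉ P) (hu : u * a ∈ I) (hv : v * b ∈ I) (c : R) :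
    ∃ s ∉ P, s * ((u ^ n - v ^ n) * c) ∈ I ^ 3 := by
  refine ⟨a ^ n * b ^ n, fun h => ?_, ?_⟩
  · rcases Ideal.IsPrime.mem_or_mem ‹_› h with h | h
    · exact ha (Ideal.IsPrime.mem_of_pow_mem ‹_› n h)
    · exact hb (Ideal.IsPrime.mem_of_pow_mem ‹_› n h)
  · have hu' := Ideal.pow_le_pow_right hn (Ideal.pow_mem_pow hu n)
    have hv' := Ideal.pow_le_pow_right hn (Ideal.pow_mem_pow hv n)
    have := Ideal.sub_mem _ (Ideal.mul_mem_left _ (b ^ n * c) hu')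
      (Ideal.mul_mem_left _ (a ^ n * c) hv')
    convert this using 1
    ring

/-- A prime containing `u` but not `v` does not contain `uⁿ - vⁿ`, for `n ≥ 1`. -/
theorem pow_sub_pow_notMem {R : Type*} [CommRing R] {P : Ideal R} [P.IsPrime] {n : ℕ}
    (hn : n ≠ 0) {u v : R} (hu : u ∈ P) (hv : v ∉ P) : u ^ n - v ^ n ∉ P := fun h =>
  hv (Ideal.IsPrime.mem_of_pow_mem ‹_› n
    ((Submodule.sub_mem_iff_right P (Ideal.pow_mem_of_mem P hu n (Nat.pos_of_ne_zero hn))).mp h))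

/-- If `u` and `v (wⁿ - uⁿ)` lie in a prime, then so does `v` or `w`. -/
theorem mem_or_mem_of_mul_pow_sub_pow_mem {R : Type*} [CommRing R] {P : Ideal R} [P.IsPrime]
    {n : ℕ} (hn : n ≠ 0) {u v w : R} (hu : u ∈ P) (h : v * (w ^ n - u ^ n) ∈ P) :
    v ∈ P ∨ w ∈ P := by
  by_contra! hvw
  rcases Ideal.IsPrime.mem_or_mem ‹_› h with h | h
  · exact hvw.1 h
  · exact pow_sub_pow_notMem hn hu hvw.2 (by simpa using P.neg_mem h)

/-- A minimal prime of the Fermat ideal does not contain all three variables. -/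
theorem X_two_notMem_of_mem_minimalPrimes {K : Type*} [Field K] {n : ℕ}
    {P : Ideal (MvPolynomial (Fin 3) K)}
    (hP : P ∈ (Ideal.span {X 0 * (X 1 ^ n - X 2 ^ n), X 1 * (X 2 ^ n - X 0 ^ n),
        X 2 * (X 0 ^ n - X 1 ^ n)} : Ideal (MvPolynomial (Fin 3) K)).minimalPrimes)
    (hx : X 0 ∈ P) (hy : X 1 ∈ P) : X 2 ∉ P := by
  intro hz
  let φ : MvPolynomial (Fin 3) K →ₐ[K] MvPolynomial (Fin 3) K := aeval ![0, 0, X 2]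
  have hφP : (Ideal.Quotient.mkₐ K P).comp φ = Ideal.Quotient.mkₐ K P := by
    ext i
    fin_cases i
    · simpa [φ] using (Ideal.Quotient.eq_zero_iff_mem.mpr hx).symm
    · simpa [φ] using (Ideal.Quotient.eq_zero_iff_mem.mpr hy).symm
    · simp [φ]
  have hle : RingHom.ker φ ≤ P := fun f hf => by
    have h := DFunLike.congr_fun hφP f
    rw [AlgHom.comp_apply, (RingHom.mem_ker).mp hf, map_zero] at h
    exact Ideal.Quotient.eq_zero_iff_mem.mp h.symm
  have hI : Ideal.span {X 0 * (X 1 ^ n - X 2 ^ n), X 1 * (X 2 ^ n - X 0 ^ n),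
      X 2 * (X 0 ^ n - X 1 ^ n)} ≤ RingHom.ker φ := by
    rw [Ideal.span_le]
    rintro _ (rfl | rfl | rfl) <;> simp [φ, RingHom.mem_ker]
  have hX2 := hP.2 ⟨RingHom.ker_isPrime φ, hI⟩ hle hz
  simp [φ, RingHom.mem_ker] at hX2

end FermatConfiguration

open FermatConfiguration in
/-- for `n ≥ 3` and a field `K` of characteristic `∉ {2,3}`
containing `n` distinct `n`-th roots of unity, the defining ideal
`I = (x(yⁿ−zⁿ), y(zⁿ−xⁿ), z(xⁿ−yⁿ))` of the Fermat configuration satisfies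
`I⁽³⁾ ⊄ I²`: some element of the third symbolic power
`I⁽³⁾ = ⋂_{P ∈ Min(I)} (I³R_P ∩ R)` does not belong to `I²`. -/
theorem fermat_symbolic_cube_not_in_square {K : Type*} [Field K] (n : ℕ)
    (hn : 3 ≤ n) (h2 : ringChar K ≠ 2) (h3 : ringChar K ≠ 3)
    (hroots : ∃ S : Finset K, S.card = n ∧ ∀ a ∈ S, a ^ n = 1) :
    let R := MvPolynomial (Fin 3) K
    let I : Ideal R := Ideal.span
      {X 0 * (X 1 ^ n - X 2 ^ n), X 1 * (X 2 ^ n - X 0 ^ n),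
        X 2 * (X 0 ^ n - X 1 ^ n)}
    ∃ F : R,
      (∀ P ∈ I.minimalPrimes, ∃ s ∉ P, s * F ∈ I ^ 3) ∧ F ∉ I ^ 2 := by
  intro R I
  have hn0 : n ≠ 0 := by omega
  refine ⟨(X 0 ^ n - X 1 ^ n) * (X 1 ^ n - X 2 ^ n) * (X 2 ^ n - X 0 ^ n), fun P hP => ?_,
    fun hF => ?_⟩
  · have hprime : P.IsPrime := hP.1.1
    have hf : X 0 * (X 1 ^ n - X 2 ^ n) ∈ I := Ideal.subset_span (by simp)
    have hg : X 1 * (X 2 ^ n - X 0 ^ n) ∈ I := Ideal.subset_span (by simp)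
    have hh : X 2 * (X 0 ^ n - X 1 ^ n) ∈ I := Ideal.subset_span (by simp)
    have hle : I ≤ P := hP.1.2
    have hxyz := X_two_notMem_of_mem_minimalPrimes hP
    have neg_notMem {u v : R} (h : u - v ∉ P) : v - u ∉ P := fun h' =>
      h (by simpa using P.neg_mem h')
    have two_mem : (X 0 : R) ∈ P ∨ (X 1 : R) ∈ P ∨ (X 2 : R) ∈ P →
        ((X 0 : R) ∈ P ∧ (X 1 : R) ∈ P) ∨ ((X 1 : R) ∈ P ∧ (X 2 : R) ∈ P) ∨
          ((X 2 : R) ∈ P ∧ (X 0 : R) ∈ P) := by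
      have hx := fun h => mem_or_mem_of_mul_pow_sub_pow_mem (P := P) hn0 h (hle hg)
      have hy := fun h => mem_or_mem_of_mul_pow_sub_pow_mem (P := P) hn0 h (hle hh)
      have hz := fun h => mem_or_mem_of_mul_pow_sub_pow_mem (P := P) hn0 h (hle hf)
      tauto
    by_cases hvar : (X 0 : R) ∈ P ∨ (X 1 : R) ∈ P ∨ (X 2 : R) ∈ P
    · rcases two_mem hvar with ⟨hu, hv⟩ | ⟨hu, hv⟩ | ⟨hu, hv⟩
      · have hw : (X 2 : R) ∉ P := hxyz hu hv
        rw [mul_assoc]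
        exact exists_notMem_mul_mem_cube hn (pow_sub_pow_notMem hn0 hv hw)
          (neg_notMem (pow_sub_pow_notMem hn0 hu hw)) hf hg _
      · have hw : (X 0 : R) ∉ P := fun h => hxyz h hu hv
        rw [mul_comm (X 0 ^ n - X 1 ^ n), mul_assoc]
        exact exists_notMem_mul_mem_cube hn (pow_sub_pow_notMem hn0 hv hw)
          (neg_notMem (pow_sub_pow_notMem hn0 hu hw)) hg hh _
      · have hw : (X 1 : R) ∉ P := fun h => hxyz hv h hu
        rw [mul_comm]
        exact exists_notMem_mul_mem_cube hn (pow_sub_pow_notMem hn0 hv hw)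
          (neg_notMem (pow_sub_pow_notMem hn0 hu hw)) hh hf _
    · push Not at hvar
      refine ⟨X 0 * X 1 * X 2, fun h => ?_, ?_⟩
      · rcases hprime.mem_or_mem h with h | h
        · exact (hprime.mem_or_mem h).elim hvar.1 hvar.2.1
        · exact hvar.2.2 h
      · have h := Ideal.mul_mem_mul (Ideal.mul_mem_mul hf hg) hh
        rw [← pow_two, ← pow_succ] at h
        convert h using 1
        ring
  · have h := coeff_eq_of_mem_sq (by omega) hF
    obtain ⟨hy, hz⟩ := coeff_fermat_arrangement (K := K) (n := n) (by omega)
    rw [hy, hz] at h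
    exact Ring.two_ne_zero h2 (by linear_combination h)
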